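/- If the adversary may duplicate and reorder messages (replay), but the blockchain's contract map makes Open(bid) idempotent-after-first and Close(bid, K) idempotent-after-first, then the final ledger state is independent of the number of duplicate deliveries of Open and Close messages: any two traces with the same set of distinct (bid, K) messages accepted yield the same final balances. -/

import Mathlib

/-- Contract status recorded by the blockchain per identifier. -/
inductive RState (Digest : Type) where
  | opened (X : Digest)
  | closed

/-- Messages that may be duplicated and reordered by the adversary. -/
inductive RMsg (BID Key Digest : Type) where
  | op (bid : BID) (X : Digest)
  | cl (bid : BID) (K : Key)
deriving DecidableEq

/-- `true` iff the message is an Open (resp. Close) for identifier `bid`. -/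
def RMsg.isOpFor {BID Key Digest : Type} [DecidableEq BID]
    (bid : BID) : RMsg BID Key Digest → Bool
  | .op b _ => b = bid
  | .cl _ _ => false

def RMsg.isClFor {BID Key Digest : Type} [DecidableEq BID]
    (bid : BID) : RMsg BID Key Digest → Bool
  | .op _ _ => false
  | .cl b _ => b = bid

open Classical in
/-- One processing step.  The accumulator carries the contract map, the number
of transfers per identifier, and the list of accepted messages (those that
caused a state change).  `op bid X` applies only if `bid` is unmapped;
`cl bid K` applies only if `bid ↦ Open X` with `H K = X`, producing one
transfer; all other deliveries (in particular duplicates) are ignored. -/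
noncomputable def rStep {BID Key Digest : Type} [DecidableEq BID]
    (H : Key → Digest)
    (acc : (BID → Option (RState Digest)) × (BID → ℕ) × List (RMsg BID Key Digest))
    (m : RMsg BID Key Digest) :
    (BID → Option (RState Digest)) × (BID → ℕ) × List (RMsg BID Key Digest) :=
  match m with
  | .op bid X =>
      match acc.1 bid with
      | none => (Function.update acc.1 bid (some (RState.opened X)),
                 acc.2.1, acc.2.2 ++ [m])
      | some _ => acc
  | .cl bid K =>
      match acc.1 bid with
      | some (RState.opened X) =>
          if H K = X then
            (Function.update acc.1 bid (some RState.closed),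
             Function.update acc.2.1 bid (acc.2.1 bid + 1),
             acc.2.2 ++ [m])
          else acc
      | _ => acc

/-- Run a trace of (possibly duplicated) messages from the empty blockchain
state, returning the final contract map, the transfer counts (the final
balances), and the accepted set. -/
noncomputable def rRun {BID Key Digest : Type} [DecidableEq BID]
    (H : Key → Digest) (T : List (RMsg BID Key Digest)) :
    (BID → Option (RState Digest)) × (BID → ℕ) × List (RMsg BID Key Digest) :=
  T.foldl (rStep H) (fun _ => none, fun _ => 0, [])

/-- Invariant tying the ledger at one identifier to the accepted list. -/
def RInv {BID Key Digest : Type} [DecidableEq BID]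
    (acc : (BID → Option (RState Digest)) × (BID → ℕ) × List (RMsg BID Key Digest))
    (b : BID) : Prop :=
  (acc.1 b = none ∧ acc.2.2.countP (RMsg.isOpFor b) = 0 ∧
    acc.2.2.countP (RMsg.isClFor b) = 0 ∧ acc.2.1 b = 0) ∨
  (∃ X, acc.1 b = some (RState.opened X) ∧ acc.2.2.countP (RMsg.isOpFor b) = 1 ∧
    acc.2.2.countP (RMsg.isClFor b) = 0 ∧ acc.2.1 b = 0 ∧
    ∀ X', RMsg.op b X' ∈ acc.2.2 ↔ X' = X) ∨
  (acc.1 b = some RState.closed ∧ acc.2.2.countP (RMsg.isOpFor b) = 1 ∧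
    acc.2.2.countP (RMsg.isClFor b) = 1 ∧ acc.2.1 b = 1)

theorem rInv_step {BID Key Digest : Type} [DecidableEq BID] (H : Key → Digest)
    (acc : (BID → Option (RState Digest)) × (BID → ℕ) × List (RMsg BID Key Digest))
    (m : RMsg BID Key Digest) (h : ∀ b, RInv acc b) (b : BID) :
    RInv (rStep H acc m) b := by
  have hb := h b
  obtain ⟨s, c, L⟩ := acc
  cases m with
  | op b' X =>
    cases hs : s b' with
    | some v => simpa [rStep, hs] using hb
    | none =>
      by_cases e : b' = b
      · subst e
        have h0 : ∀ X', RMsg.op b' X' ∉ L := by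
          intro X' hX
          have : L.countP (RMsg.isOpFor b') = 0 := by
            rcases hb with hb | ⟨Y, hb, _⟩ | hb
            · exact hb.2.1
            · simp [hs] at hb
            · simp [hs] at hb
          have := List.countP_eq_zero.1 this _ hX
          simp [RMsg.isOpFor] at this
        simp only [RInv, hs] at hb
        right; left
        refine ⟨X, ?_⟩
        simp_all [rStep, RMsg.isOpFor, RMsg.isClFor, List.countP_append]
      · have e' : b ≠ b' := fun h => e h.symm
        simpa [RInv, rStep, hs, e, e', RMsg.isOpFor, RMsg.isClFor, List.countP_append,
          Function.update_of_ne] using hb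
  | cl b' K =>
    cases hs : s b' with
    | none => simpa [rStep, hs] using hb
    | some v =>
      cases v with
      | closed => simpa [rStep, hs] using hb
      | opened X =>
        by_cases hK : H K = X
        · by_cases e : b' = b
          · subst e
            simp only [RInv, hs] at hb
            right; right
            simp_all [rStep, RMsg.isOpFor, RMsg.isClFor, List.countP_append]
          · have e' : b ≠ b' := fun h => e h.symm
            simpa [RInv, rStep, hs, hK, e, e', RMsg.isOpFor, RMsg.isClFor, List.countP_append,
              Function.update_of_ne] using hb
        · simpa [rStep, hs, hK] using hb

theorem rInv_run {BID Key Digest : Type} [DecidableEq BID] (H : Key → Digest)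
    (T : List (RMsg BID Key Digest)) (b : BID) : RInv (rRun H T) b := by
  suffices hh : ∀ (T : List (RMsg BID Key Digest)) acc, (∀ b, RInv acc b) →
      ∀ b, RInv (T.foldl (rStep H) acc) b from
    hh T _ (fun b => Or.inl (by simp)) b
  intro T
  induction T with
  | nil => intro acc h; exact h
  | cons m T ih => intro acc h; exact ih _ (rInv_step H acc m h)

theorem countP_zero_congr {α : Type} (p : α → Bool) (L M : List α)
    (h : ∀ m, m ∈ L ↔ m ∈ M) : L.countP p = 0 ↔ M.countP p = 0 := by
  simp [List.countP_eq_zero, h]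

theorem rInv_eq {BID Key Digest : Type} [DecidableEq BID]
    (a a' : (BID → Option (RState Digest)) × (BID → ℕ) × List (RMsg BID Key Digest))
    (b : BID) (h : RInv a b) (h' : RInv a' b) (hm : ∀ m, m ∈ a.2.2 ↔ m ∈ a'.2.2) :
    a.1 b = a'.1 b ∧ a.2.1 b = a'.2.1 b := by
  have ho := countP_zero_congr (RMsg.isOpFor b) _ _ hm
  have hc := countP_zero_congr (RMsg.isClFor b) _ _ hm
  rcases h with ⟨h1, h2, h3, h4⟩ | ⟨X, h1, h2, h3, h4, h5⟩ | ⟨h1, h2, h3, h4⟩ <;>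
  rcases h' with ⟨k1, k2, k3, k4⟩ | ⟨Y, k1, k2, k3, k4, k5⟩ | ⟨k1, k2, k3, k4⟩ <;>
  first
  | (exfalso; omega)
  | exact ⟨h1.trans k1.symm, h4.trans k4.symm⟩
  | (have : X = Y := (k5 X).1 ((hm _).1 ((h5 X).2 rfl))
     subst this
     exact ⟨h1.trans k1.symm, h4.trans k4.symm⟩)

/-- under replay (duplication and reordering of deliveries),
the final ledger state depends only on the accepted set of messages: any two
traces whose accepted sets coincide yield the same final contract map and the
same final transfer counts (balances); moreover duplicates never enter the
accepted set twice for the same identifier — at most one Open and at most one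
Close per `bid` are ever accepted. -/
theorem final_state_determined_by_accepted_set
    {BID Key Digest : Type} [DecidableEq BID] (H : Key → Digest)
    (T₁ T₂ : List (RMsg BID Key Digest))
    (hAcc : ∀ m, m ∈ (rRun H T₁).2.2 ↔ m ∈ (rRun H T₂).2.2) :
    ((rRun H T₁).1 = (rRun H T₂).1 ∧ (rRun H T₁).2.1 = (rRun H T₂).2.1) ∧
    (∀ bid : BID,
      ((rRun H T₁).2.2.countP (RMsg.isOpFor bid) ≤ 1 ∧
       (rRun H T₁).2.2.countP (RMsg.isClFor bid) ≤ 1)) := by 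
  refine ⟨⟨?_, ?_⟩, ?_⟩
  · funext b
    exact (rInv_eq _ _ b (rInv_run H T₁ b) (rInv_run H T₂ b) hAcc).1
  · funext b
    exact (rInv_eq _ _ b (rInv_run H T₁ b) (rInv_run H T₂ b) hAcc).2
  · intro b
    rcases rInv_run H T₁ b with ⟨_, h2, h3, _⟩ | ⟨X, _, h2, h3, _⟩ | ⟨_, h2, h3, _⟩ <;>
      constructor <;> omega
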